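/- Let x ∈ ℝ^n lie in a linear subspace W ⊆ ℝ^n defined over ℚ. For every η₀ > 0, the point x lies in the convex hull of finitely many rational points y_1,...,y_k ∈ W ∩ ℚ^n, each of which satisfies: there is a positive integer q_j with q_j y_j ∈ ℤ^n and ‖q_j(x - y_j)‖ < η₀. -/

import Mathlib

open Finset in
theorem aux_hull {E : Type*} [NormedAddCommGroup E] [NormedSpace ℝ E] [FiniteDimensional ℝ E]
    (C : Set E) (hne : C.Nonempty)
    (hC : ∀ b ∈ C, ∀ ε : ℝ, 0 < ε → ∃ c ∈ C, ‖c + b‖ < ε) : (0 : E) ∈ convexHull ℝ C := by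
  obtain ⟨f, hf, hspan, hli⟩ := Submodule.exists_fun_fin_finrank_span_eq ℝ C
  generalize Module.finrank ℝ (Submodule.span ℝ C) = r at f hf hspan hli
  rcases Nat.eq_zero_or_pos r with hr | hr
  · subst hr
    obtain ⟨c, hc⟩ := hne
    have h1 : c ∈ Submodule.span ℝ C := Submodule.subset_span hc
    rw [← hspan] at h1
    simp at h1
    subst h1
    exact subset_convexHull ℝ C hc
  obtain ⟨K, hK, hanti⟩ := LinearMap.exists_antilipschitzWith (Fintype.linearCombination ℝ f)
    (by rw [LinearMap.ker_eq_bot]; exact hli.fintypeLinearCombination_injective)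
  have hKr : (0 : ℝ) < K := by exact_mod_cast hK
  have hr' : (0 : ℝ) < r := by exact_mod_cast hr
  have hε : (0 : ℝ) < 1 / (K * r) := by positivity
  choose c hcC hc using fun i => hC (f i) (hf i) _ hε
  have ha : ∑ i, c i ∈ Submodule.span ℝ (Set.range f) := by
    rw [hspan]
    exact Submodule.sum_mem _ fun i _ => Submodule.subset_span (hcC i)
  obtain ⟨u, hu⟩ := (Submodule.mem_span_range_iff_exists_fun ℝ).1 ha
  have hnorm : ‖∑ i, c i + ∑ i, f i‖ < 1 / K := by
    rw [← Finset.sum_add_distrib]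
    have : Nonempty (Fin r) := ⟨⟨0, hr⟩⟩
    calc ‖∑ i, (c i + f i)‖ ≤ ∑ i, ‖c i + f i‖ := norm_sum_le _ _
      _ < ∑ i : Fin r, 1 / (K * r : ℝ) := Finset.sum_lt_sum_of_nonempty Finset.univ_nonempty
          fun i _ => hc i
      _ = 1 / K := by simp; field_simp
  have hu1 : ‖u + 1‖ < 1 := by
    have h1 := hanti.le_mul_norm_sub (x := u + 1) (y := 0)
    have h2 : Fintype.linearCombination ℝ f (u + 1) = ∑ i, c i + ∑ i, f i := by
      rw [← hu]
      simp [Fintype.linearCombination_apply, add_smul, Finset.sum_add_distrib]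
    simp only [map_zero, add_zero, norm_neg, h2] at h1
    calc _ ≤ _ := h1
      _ < K * (1 / K) := by gcongr
      _ = 1 := by field_simp
  have hneg : ∀ j, u j < 0 := fun j => by
    have := (norm_le_pi_norm (u + 1) j).trans_lt hu1
    rw [Real.norm_eq_abs, abs_lt] at this
    simp at this
    linarith [this.2]
  have key := Finset.centerMass_mem_convexHull (R := ℝ) (s := C)
    (Finset.univ : Finset (Fin r ⊕ Fin r)) (w := Sum.elim (fun _ => 1) (fun j => - u j))
    (z := Sum.elim c f)
    (by rintro (i | i) _ <;> simp; exact (hneg i).le)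
    (by
      rw [Fintype.sum_sum_type]
      have : 0 ≤ ∑ j, - u j := Finset.sum_nonneg fun j _ => by linarith [hneg j]
      simp at this ⊢
      linarith)
    (by rintro (i | i) _ <;> simp [hcC, hf])
  rw [Finset.centerMass, Fintype.sum_sum_type (f := fun i => _ • _)] at key
  simpa [← hu] using key

theorem aux_dirichlet (d : ℕ) (t : Fin d → ℝ) (q : ℕ) (ε : ℝ) (hε : 0 < ε) :
    ∃ m : ℕ, q < m ∧ ∃ p : Fin d → ℤ, ∀ i, |m * t i - p i| < ε := by
  have hcomp : IsCompact (Set.pi Set.univ (fun _ : Fin d => Set.Icc (0 : ℝ) 1)) :=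
    isCompact_univ_pi fun _ => isCompact_Icc
  obtain ⟨a, -, φ, hφ, hlim⟩ := hcomp.tendsto_subseq
    (x := fun m : ℕ => fun i => Int.fract (m * t i))
    (fun m i _ => ⟨Int.fract_nonneg _, (Int.fract_lt_one _).le⟩)
  obtain ⟨N, hN⟩ := Metric.cauchySeq_iff.1 hlim.cauchySeq ε hε
  have hM := hN (N + φ N + q + 1) (by omega) N le_rfl
  have hle : N + φ N + q + 1 ≤ φ (N + φ N + q + 1) := hφ.le_apply
  simp only [Function.comp] at hM
  generalize φ (N + φ N + q + 1) = M at hM hle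
  refine ⟨M - φ N, by omega, fun i => ⌊M * t i⌋ - ⌊φ N * t i⌋, fun i => ?_⟩
  have h2 := (dist_le_pi_dist _ _ i).trans_lt hM
  simp only [Real.dist_eq, Int.fract] at h2
  rw [Nat.cast_sub (by omega)]
  push_cast
  refine lt_of_eq_of_lt (congrArg _ ?_) h2
  ring

theorem aux_den (n : ℕ) (v : Fin n → ℝ) (hv : ∀ i, ∃ q : ℚ, v i = (q : ℝ)) :
    ∃ D : ℕ, 0 < D ∧ ∀ i, ∃ z : ℤ, (D : ℝ) * v i = z := by
  choose g hg using hv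
  refine ⟨∏ i, (g i).den, Finset.prod_pos fun i _ => (g i).pos, fun i => ?_⟩
  obtain ⟨e, he⟩ := Finset.dvd_prod_of_mem (fun i => (g i).den) (Finset.mem_univ i)
  refine ⟨e * (g i).num, ?_⟩
  rw [hg, he]
  have : ((g i).den : ℝ) * (g i : ℝ) = (g i).num := by exact_mod_cast Rat.den_mul_eq_num (g i)
  push_cast
  rw [← this]; ring

theorem aux_W (n : ℕ) (W : Submodule ℝ (Fin n → ℝ))
    (hW : ∃ S : Set (Fin n → ℝ),
      (∀ v ∈ S, ∀ i, ∃ q : ℚ, v i = (q : ℝ)) ∧ W = Submodule.span ℝ S)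
    (x : Fin n → ℝ) (hx : x ∈ W) (q : ℕ) (ε : ℝ) (hε : 0 < ε) :
    ∃ m : ℕ, q < m ∧ ∃ p ∈ W, (∀ i, ∃ z : ℤ, p i = z) ∧ ‖(m : ℝ) • x - p‖ < ε := by
  obtain ⟨S, hS, rfl⟩ := hW
  obtain ⟨d, t, g, hg⟩ := Submodule.mem_span_set'.1 hx
  choose D hD z hz using fun k => aux_den n (g k) (hS _ (g k).2)
  have hpos : 0 < ∑ k, ‖(D k : ℝ) • (g k : Fin n → ℝ)‖ + 1 := by positivity
  obtain ⟨m, hm, p, hp⟩ := aux_dirichlet d (fun k => t k / D k) q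
    (ε / (∑ k, ‖(D k : ℝ) • (g k : Fin n → ℝ)‖ + 1)) (by positivity)
  refine ⟨m, hm, ∑ k, (p k : ℝ) • (D k : ℝ) • (g k : Fin n → ℝ), ?_, fun i => ?_, ?_⟩
  · exact Submodule.sum_mem _ fun k _ => Submodule.smul_mem _ _ (Submodule.smul_mem _ _
      (Submodule.subset_span (g k).2))
  · refine ⟨∑ k, p k * z k i, ?_⟩
    simp [hz]
  · have : (m : ℝ) • x - ∑ k, (p k : ℝ) • (D k : ℝ) • (g k : Fin n → ℝ)
        = ∑ k, (m * (t k / D k) - p k) • (D k : ℝ) • (g k : Fin n → ℝ) := by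
      rw [← hg, Finset.smul_sum, ← Finset.sum_sub_distrib]
      refine Finset.sum_congr rfl fun k _ => ?_
      have : (D k : ℝ) ≠ 0 := by exact_mod_cast (hD k).ne'
      rw [sub_smul, smul_smul, smul_smul (_ * _)]
      congr 2
      field_simp
    rw [this]
    calc _ ≤ ∑ k, ‖(m * (t k / D k) - p k) • (D k : ℝ) • (g k : Fin n → ℝ)‖ := norm_sum_le _ _
      _ ≤ ∑ k, (ε / (∑ k, ‖(D k : ℝ) • (g k : Fin n → ℝ)‖ + 1)) *
            ‖(D k : ℝ) • (g k : Fin n → ℝ)‖ := by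
          refine Finset.sum_le_sum fun k _ => ?_
          rw [norm_smul (_ - _)]
          exact mul_le_mul_of_nonneg_right (hp k).le (norm_nonneg _)
      _ < ε := by
          rw [← Finset.mul_sum, div_mul_eq_mul_div, div_lt_iff₀ hpos]
          nlinarith


/-- Property A.4 of the approximation Lemma 3.6: the real point is a convex
combination of finitely many good rational approximants. -/
theorem stmt_5 (n : ℕ) (W : Submodule ℝ (Fin n → ℝ))
    (hW : ∃ S : Set (Fin n → ℝ),
      (∀ v ∈ S, ∀ i, ∃ q : ℚ, v i = (q : ℝ)) ∧ W = Submodule.span ℝ S)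
    (x : Fin n → ℝ) (hx : x ∈ W) (η₀ : ℝ) (hη₀ : 0 < η₀) :
    ∃ (k : ℕ) (y : Fin k → (Fin n → ℝ)),
      0 < k ∧
      (∀ j, y j ∈ W) ∧
      (∀ j i, ∃ r : ℚ, y j i = (r : ℝ)) ∧
      (∀ j, ∃ q : ℕ, 0 < q ∧ (∀ i, ∃ z : ℤ, (q : ℝ) * y j i = (z : ℝ)) ∧
        (∀ i, |(q : ℝ) * (x i - y j i)| < η₀)) ∧
      x ∈ convexHull ℝ (Set.range y) := by
  set C : Set (Fin n → ℝ) := {v | ∃ q : ℕ, 0 < q ∧ ∃ p ∈ W, (∀ i, ∃ z : ℤ, p i = z) ∧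
    v = (q : ℝ) • x - p ∧ ‖v‖ < η₀} with hCdef
  have h0 : (0 : Fin n → ℝ) ∈ convexHull ℝ C := by
    apply aux_hull
    · obtain ⟨m, hm, p, hpW, hp, hlt⟩ := aux_W n W hW x hx 0 η₀ hη₀
      exact ⟨_, m, hm, p, hpW, hp, rfl, hlt⟩
    · rintro b ⟨q, hq, p, hpW, hp, rfl, hlt⟩ ε hε
      obtain ⟨m, hm, p', hpW', hp', hlt'⟩ := aux_W n W hW x hx q
        (min ε (η₀ - ‖(q : ℝ) • x - p‖)) (lt_min hε (by linarith))
      have e : ((m - q : ℕ) : ℝ) • x - (p' - p)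
          = ((m : ℝ) • x - p') - ((q : ℝ) • x - p) := by
        rw [Nat.cast_sub hm.le, sub_smul]; abel
      refine ⟨((m - q : ℕ) : ℝ) • x - (p' - p), ⟨m - q, by omega, p' - p, W.sub_mem hpW' hpW,
        fun i => ?_, rfl, ?_⟩, ?_⟩
      · obtain ⟨a, ha⟩ := hp i
        obtain ⟨b, hb⟩ := hp' i
        exact ⟨b - a, by simp [ha, hb]⟩
      · rw [e]
        have := norm_sub_le ((m : ℝ) • x - p') ((q : ℝ) • x - p)
        have := hlt'.trans_le (min_le_right _ _)
        linarith
      · rw [e, sub_add_cancel]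
        exact hlt'.trans_le (min_le_left _ _)
  obtain ⟨ι, hι, w, v, hw0, hw1, hv, hsum⟩ := mem_convexHull_iff_exists_fintype.1 h0
  choose q hq p hpW hp hvq hlt using hv
  have hq' : ∀ j, (0 : ℝ) < q j := fun j => by exact_mod_cast hq j
  let e := (Fintype.equivFin ι).symm
  have hne : Nonempty ι := by
    by_contra h
    rw [not_nonempty_iff] at h
    simp at hw1
  let y : ι → (Fin n → ℝ) := fun j => (q j : ℝ)⁻¹ • p j
  have hqy : ∀ j i, (q j : ℝ) * y j i = p j i := fun j i => by
    have := (hq' j).ne'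
    simp [y]; field_simp
  refine ⟨Fintype.card ι, y ∘ e, Fintype.card_pos, fun j => W.smul_mem _ (hpW _), fun j i => ?_,
    fun j => ⟨q (e j), hq _, fun i => ?_, fun i => ?_⟩, ?_⟩
  · obtain ⟨z, hz⟩ := hp (e j) i
    exact ⟨(q (e j) : ℚ)⁻¹ * z, by simp [y, hz]⟩
  · obtain ⟨z, hz⟩ := hp (e j) i
    exact ⟨z, by rw [← hz]; exact hqy _ _⟩
  · rw [mul_sub]
    have h1 := (norm_le_pi_norm _ i).trans_lt (hlt (e j))
    rw [hvq] at h1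
    simp only [Function.comp, hqy]
    simpa using h1
  · rw [EquivLike.range_comp y e]
    have hpos : 0 < ∑ j, w j * q j := by
      have hnn : ∀ j ∈ Finset.univ, 0 ≤ w j * q j := fun j _ => mul_nonneg (hw0 j) (hq' j).le
      refine lt_of_lt_of_le (b := ∑ j, w j) (by rw [hw1]; exact one_pos) ?_
      refine Finset.sum_le_sum fun j _ => ?_
      have : (1 : ℝ) ≤ q j := by exact_mod_cast hq j
      nlinarith [hw0 j]
    have key := Finset.centerMass_mem_convexHull (R := ℝ) (s := Set.range y) Finset.univ
      (w := fun j => w j * q j) (z := y) (fun j _ => mul_nonneg (hw0 j) (hq' j).le) hpos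
      (fun j _ => ⟨j, rfl⟩)
    have hx' : Finset.centerMass Finset.univ (fun j => w j * q j) y = x := by
      rw [Finset.centerMass, inv_smul_eq_iff₀ hpos.ne', Finset.sum_smul, ← sub_eq_zero,
        ← Finset.sum_sub_distrib, ← neg_eq_zero, ← Finset.sum_neg_distrib, ← hsum]
      refine Finset.sum_congr rfl fun j _ => ?_
      rw [hvq j]
      ext i
      have := hqy j i
      simp only [Pi.neg_apply, Pi.sub_apply, Pi.smul_apply, smul_eq_mul]
      rw [← this]; ring
    rwa [hx'] at key
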